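/- Let k ≥ 2, let n ∈ ℕ, let μ̂ be any measurable estimator mapping n observation pairs in ([0,1] × {1,…,k})^n to a k-tuple of probability measures on [0,1], and let δ > 0. Then there exists a k-tuple of probability densities D = (f_1, …, f_k) on [0,1], whose CDFs satisfy |F_i(x) − F_i(y)| ≥ λ|x − y| for all x, y ∈ [0,1] for some λ ∈ (0, 1/2), such that the probability, over n i.i.d. samples W = (Y_i, Z_i)_{i=1}^n from the first-price observation model on D, that max_j d_K(μ̂(W)_j, f_j) ≤ 1/4, is at most 1/2 + δ. -/

import Mathlib

open MeasureTheory ProbabilityTheory Finset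
open scoped ENNReal NNReal

/-- The (least) index attaining the maximum of a finite tuple of reals. -/
noncomputable def argmaxIdx {k : ℕ} [NeZero k] (x : Fin k → ℝ) : Fin k :=
  (Finset.univ.filter fun i => ∀ j, x j ≤ x i).min' (by
    obtain ⟨i, -, hi⟩ := Finset.exists_max_image (Finset.univ : Finset (Fin k)) x
      ⟨⟨0, Nat.pos_of_ne_zero (NeZero.ne k)⟩, Finset.mem_univ _⟩
    exact ⟨i, Finset.mem_filter.mpr ⟨Finset.mem_univ i, fun j => hi j (Finset.mem_univ j)⟩⟩)

/-- The measure on `ℝ` with Lebesgue density `f`. -/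
noncomputable def densityMeasure (f : ℝ → ℝ) : Measure ℝ :=
  MeasureTheory.volume.withDensity fun x => ENNReal.ofReal (f x)

/-- The law of a single observation `(Y, Z) = (max_i X_i, argmax_i X_i)` of a first-price
auction whose `k` independent bids have densities `f i`. -/
noncomputable def firstPriceObsLaw {k : ℕ} [NeZero k] (f : Fin k → ℝ → ℝ) :
    Measure (ℝ × Fin k) :=
  Measure.map (fun x => (⨆ i, x i, argmaxIdx x))
    (Measure.pi fun i => densityMeasure (f i))

/-- The law of `n` i.i.d. observations from the first-price auction model. -/
noncomputable def firstPriceSamplesLaw {k : ℕ} [NeZero k] (n : ℕ) (f : Fin k → ℝ → ℝ) :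
    Measure (Fin n → ℝ × Fin k) :=
  Measure.pi fun _ => firstPriceObsLaw f

/-- `f` is a probability density supported on `[0,1]`. -/
def IsDensityOn01 (f : ℝ → ℝ) : Prop :=
  Measurable f ∧ (∀ x, 0 ≤ f x) ∧ (∀ x, x ∉ Set.Icc (0:ℝ) 1 → f x = 0) ∧ (∫ x, f x) = 1

/-- The CDF of a density `f`. -/
noncomputable def cdfOf (f : ℝ → ℝ) (x : ℝ) : ℝ := ∫ t in Set.Iic x, f t

/-- The Kolmogorov distance between two measures on `ℝ`: the sup distance of their CDFs. -/
noncomputable def kolmogorovDist (P Q : Measure ℝ) : ℝ :=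
  ⨆ x : ℝ, |(P (Set.Iic x)).toReal - (Q (Set.Iic x)).toReal|

/-- Product measures are monotone in their factors. -/
lemma measurePi_mono {ι : Type*} [Fintype ι] {α : ι → Type*} [∀ i, MeasurableSpace (α i)]
    {μ ν : ∀ i, Measure (α i)} [∀ i, SigmaFinite (μ i)] (h : ∀ i, μ i ≤ ν i) :
    Measure.pi μ ≤ Measure.pi ν := by
  refine Measure.le_iff.2 fun s hs => ?_
  rw [Measure.pi_def ν, toMeasure_apply _ _ hs]
  suffices (Measure.pi μ).toOuterMeasure ≤ OuterMeasure.pi fun i => (ν i).toOuterMeasure from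
    this s
  rw [OuterMeasure.le_pi]
  intro t _
  exact (Measure.pi_pi μ t).le.trans (Finset.prod_le_prod' fun i _ => h i (t i))

/-- Le Cam's two-point bound: if two probability measures dominate a common measure `ρ`,
then no pair of disjoint events can have total probability above `2 - ρ univ`. -/
lemma measure_add_measure_add_le_two {Ω : Type*} [MeasurableSpace Ω] {P Q ρ : Measure Ω}
    [IsProbabilityMeasure P] [IsProbabilityMeasure Q] (hP : ρ ≤ P) (hQ : ρ ≤ Q)
    {A B : Set Ω} (hA : MeasurableSet A) (hB : MeasurableSet B) (hAB : Disjoint A B) :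
    P A + Q B + ρ Set.univ ≤ 2 := by
  have hcover : (Set.univ : Set Ω) ⊆ Aᶜ ∪ Bᶜ := by
    rw [← Set.compl_inter, hAB.inter_eq, Set.compl_empty]
  calc P A + Q B + ρ Set.univ ≤ P A + Q B + (P Aᶜ + Q Bᶜ) := by
        gcongr
        exact (measure_mono hcover).trans
          ((measure_union_le _ _).trans (add_le_add (hP _) (hQ _)))
    _ = (P A + P Aᶜ) + (Q B + Q Bᶜ) := by ring
    _ = 2 := by
        rw [prob_add_prob_compl hA, prob_add_prob_compl hB, one_add_one_eq_two]

lemma argmaxIdx_eq_iff {k : ℕ} [NeZero k] (x : Fin k → ℝ) (i : Fin k) :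
    argmaxIdx x = i ↔ (∀ j, x j ≤ x i) ∧ ∀ l, (∀ j, x j ≤ x l) → i ≤ l := by
  unfold argmaxIdx
  rw [Finset.min'_eq_iff]
  simp

lemma measurable_argmaxIdx {k : ℕ} [NeZero k] :
    Measurable (argmaxIdx : (Fin k → ℝ) → Fin k) := by
  refine measurable_to_countable' fun i => ?_
  have : (argmaxIdx : (Fin k → ℝ) → Fin k) ⁻¹' {i} =
      {x | (∀ j, x j ≤ x i) ∧ ∀ l, (∀ j, x j ≤ x l) → i ≤ l} := by
    ext x
    simp [argmaxIdx_eq_iff]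
  rw [this]
  have hmax : ∀ l : Fin k, Measurable fun x : Fin k → ℝ => ∀ j, x j ≤ x l := fun l =>
    Measurable.forall fun j => measurableSet_setOfPred.1
      (measurableSet_le (measurable_pi_apply j) (measurable_pi_apply l))
  exact measurableSet_setOfPred.2 ((hmax i).and
    (Measurable.forall fun l => (hmax l).imp measurable_const))

lemma measurable_firstPriceObs {k : ℕ} [NeZero k] :
    Measurable fun x : Fin k → ℝ => (⨆ i, x i, argmaxIdx x) :=
  (Measurable.iSup fun i => measurable_pi_apply i).prodMk measurable_argmaxIdx

/-- A strictly largest bid determines the observation. -/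
lemma firstPriceObs_eq {k : ℕ} [NeZero k] {x : Fin k → ℝ} {z : Fin k}
    (h : ∀ j, j ≠ z → x j < x z) : (⨆ i, x i, argmaxIdx x) = (x z, z) := by
  have hle : ∀ j, x j ≤ x z := fun j => by
    rcases eq_or_ne j z with rfl | hj
    · exact le_rfl
    · exact (h j hj).le
  refine Prod.ext (le_antisymm (ciSup_le hle) (le_ciSup (Set.finite_range x).bddAbove z)) ?_
  refine (argmaxIdx_eq_iff x z).2 ⟨hle, fun l hl => ?_⟩
  by_contra hlt
  have hne : l ≠ z := fun e => hlt e.ge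
  exact (h l hne).not_ge (hl z)

lemma isProbabilityMeasure_densityMeasure {f : ℝ → ℝ} (hf : IsDensityOn01 f) :
    IsProbabilityMeasure (densityMeasure f) := by
  obtain ⟨-, hpos, -, hint⟩ := hf
  have hi : Integrable f := by
    by_contra h
    rw [integral_undef h] at hint
    exact zero_ne_one hint
  refine ⟨?_⟩
  rw [densityMeasure, withDensity_apply _ MeasurableSet.univ, Measure.restrict_univ,
    ← ofReal_integral_eq_lintegral_ofReal hi (Filter.Eventually.of_forall hpos), hint,
    ENNReal.ofReal_one]

lemma isProbabilityMeasure_firstPriceObsLaw {k : ℕ} [NeZero k] {f : Fin k → ℝ → ℝ}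
    (hf : ∀ i, IsDensityOn01 (f i)) : IsProbabilityMeasure (firstPriceObsLaw f) := by
  have := fun i => isProbabilityMeasure_densityMeasure (hf i)
  exact Measure.isProbabilityMeasure_map measurable_firstPriceObs.aemeasurable

lemma abs_sub_le_kolmogorovDist (P Q : Measure ℝ) [IsProbabilityMeasure P]
    [IsProbabilityMeasure Q] (x : ℝ) :
    |(P (Set.Iic x)).toReal - (Q (Set.Iic x)).toReal| ≤ kolmogorovDist P Q := by
  refine le_ciSup (f := fun x : ℝ => |(P (Set.Iic x)).toReal - (Q (Set.Iic x)).toReal|)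
    ⟨1, ?_⟩ x
  rintro _ ⟨y, rfl⟩
  have hP : (P (Set.Iic y)).toReal ≤ 1 := measureReal_le_one
  have hQ : (Q (Set.Iic y)).toReal ≤ 1 := measureReal_le_one
  have hP' : 0 ≤ (P (Set.Iic y)).toReal := ENNReal.toReal_nonneg
  have hQ' : 0 ≤ (Q (Set.Iic y)).toReal := ENNReal.toReal_nonneg
  exact abs_le.2 ⟨by linarith, by linarith⟩

/-- The density of the mixture giving weight `ε` to the uniform law on `[0,1]` and weight `1 - ε`
to the uniform law on `[a, a + 1/4)`. -/
noncomputable def bumpDensity (ε a : ℝ) (x : ℝ) : ℝ :=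
  (Set.Icc (0:ℝ) 1).indicator (fun _ => ε) x +
    (Set.Ico a (a + 1/4)).indicator (fun _ => 4 * (1 - ε)) x

/-- The sub-probability measure of mass `1 - ε` spread uniformly over `[a, a + 1/4)`. -/
noncomputable def bumpMeasure (ε a : ℝ) : Measure ℝ :=
  ENNReal.ofReal (4 * (1 - ε)) • volume.restrict (Set.Ico a (a + 1/4))

instance (ε a : ℝ) : IsFiniteMeasure (bumpMeasure ε a) := by
  unfold bumpMeasure
  exact Measure.smul_finite _ ENNReal.ofReal_ne_top

lemma bumpMeasure_univ {ε : ℝ} (hε : ε ≤ 1) (a : ℝ) :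
    bumpMeasure ε a Set.univ = ENNReal.ofReal (1 - ε) := by
  rw [bumpMeasure, Measure.smul_apply, Measure.restrict_apply_univ, Real.volume_Ico,
    smul_eq_mul, ← ENNReal.ofReal_mul (by linarith)]
  congr 1
  ring

lemma ae_bumpMeasure_mem (ε a : ℝ) : ∀ᵐ x ∂bumpMeasure ε a, x ∈ Set.Ico a (a + 1/4) :=
  Measure.ae_smul_measure (ae_restrict_mem measurableSet_Ico) _

lemma densityMeasure_bumpDensity {ε : ℝ} (h0 : 0 ≤ ε) (h1 : ε ≤ 1) (a : ℝ) :
    densityMeasure (bumpDensity ε a) =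
      ENNReal.ofReal ε • volume.restrict (Set.Icc (0:ℝ) 1) + bumpMeasure ε a := by
  have h : (fun x => ENNReal.ofReal (bumpDensity ε a x)) =
      (Set.Icc (0:ℝ) 1).indicator (fun _ => ENNReal.ofReal ε) +
        (Set.Ico a (a + 1/4)).indicator (fun _ => ENNReal.ofReal (4 * (1 - ε))) := by
    funext x
    have h4 : 0 ≤ 4 * (1 - ε) := by linarith
    simp only [bumpDensity, Pi.add_apply]
    rw [ENNReal.ofReal_add (Set.indicator_nonneg (fun _ _ => h0) x)
      (Set.indicator_nonneg (fun _ _ => h4) x)]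
    congr 1 <;> simp only [Set.indicator_apply, apply_ite ENNReal.ofReal, ENNReal.ofReal_zero]
  rw [densityMeasure, h, withDensity_add_left (measurable_const.indicator measurableSet_Icc),
    withDensity_indicator measurableSet_Icc, withDensity_indicator measurableSet_Ico,
    withDensity_const, withDensity_const, bumpMeasure]

lemma integrable_bumpDensity (ε a : ℝ) : Integrable (bumpDensity ε a) := by
  unfold bumpDensity
  exact (integrableOn_const (by simp)).integrable_indicator measurableSet_Icc |>.add
    ((integrableOn_const (by simp)).integrable_indicator measurableSet_Ico)

lemma isDensityOn01_bumpDensity {ε a : ℝ} (h0 : 0 ≤ ε) (h1 : ε ≤ 1) (ha : 0 ≤ a)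
    (ha' : a ≤ 3/4) : IsDensityOn01 (bumpDensity ε a) := by
  have h4 : 0 ≤ 4 * (1 - ε) := by linarith
  refine ⟨(measurable_const.indicator measurableSet_Icc).add
    (measurable_const.indicator measurableSet_Ico), fun x => add_nonneg
    (Set.indicator_nonneg (fun _ _ => h0) x) (Set.indicator_nonneg (fun _ _ => h4) x), ?_, ?_⟩
  · intro x hx
    have hx' : x ∉ Set.Ico a (a + 1/4) := fun h => hx ⟨ha.trans h.1, by linarith [h.2]⟩
    simp only [bumpDensity, Set.indicator_of_notMem hx, Set.indicator_of_notMem hx', add_zero]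
  · unfold bumpDensity
    rw [integral_add ((integrableOn_const (by simp)).integrable_indicator measurableSet_Icc)
      ((integrableOn_const (by simp)).integrable_indicator measurableSet_Ico),
      integral_indicator measurableSet_Icc, integral_indicator measurableSet_Ico,
      setIntegral_const, setIntegral_const, Real.volume_real_Icc_of_le (by norm_num),
      Real.volume_real_Ico_of_le (by linarith)]
    simp only [smul_eq_mul]
    ring

lemma mul_abs_sub_le_cdfOf_bumpDensity {ε : ℝ} (h1 : ε ≤ 1) (a : ℝ) {x y : ℝ}
    (hx : x ∈ Set.Icc (0:ℝ) 1) (hy : y ∈ Set.Icc (0:ℝ) 1) :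
    ε * |x - y| ≤ |cdfOf (bumpDensity ε a) x - cdfOf (bumpDensity ε a) y| := by
  wlog hxy : x ≤ y generalizing x y
  · rw [abs_sub_comm x, abs_sub_comm (cdfOf _ x)]
    exact this hy hx (le_of_not_ge hxy)
  have hi := integrable_bumpDensity ε a
  have hdiff : cdfOf (bumpDensity ε a) y - cdfOf (bumpDensity ε a) x =
      ∫ t in Set.Ioc x y, bumpDensity ε a t := by
    rw [cdfOf, cdfOf, intervalIntegral.integral_Iic_sub_Iic hi.integrableOn hi.integrableOn,
      intervalIntegral.integral_of_le hxy]
  have hlow : ε * (y - x) ≤ ∫ t in Set.Ioc x y, bumpDensity ε a t := by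
    calc ε * (y - x) = ∫ _ in Set.Ioc x y, ε := by
          rw [setIntegral_const, Real.volume_real_Ioc_of_le hxy, smul_eq_mul, mul_comm]
      _ ≤ _ := by
          refine setIntegral_mono_on (integrableOn_const (by simp)) hi.integrableOn
            measurableSet_Ioc fun t ht => ?_
          have ht' : t ∈ Set.Icc (0:ℝ) 1 := ⟨hx.1.trans ht.1.le, ht.2.trans hy.2⟩
          simp only [bumpDensity, Set.indicator_of_mem ht']
          exact le_add_of_nonneg_right
            (Set.indicator_nonneg (fun _ _ => by linarith) t)
  rw [abs_sub_comm x, abs_sub_comm (cdfOf _ x), abs_of_nonneg (sub_nonneg.2 hxy), hdiff]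
  exact hlow.trans (le_abs_self _)

lemma Iic_quarter_inter_Icc : Set.Iic (1/4 : ℝ) ∩ Set.Icc 0 1 = Set.Icc 0 (1/4) := by
  ext t
  simp only [Set.mem_inter_iff, Set.mem_Iic, Set.mem_Icc]
  grind

lemma densityMeasure_bumpDensity_zero_Iic {ε : ℝ} (h0 : 0 ≤ ε) (h1 : ε ≤ 1) :
    (densityMeasure (bumpDensity ε 0) (Set.Iic (1/4))).toReal = 1 - 3 / 4 * ε := by
  have hJ : Set.Iic (1/4 : ℝ) ∩ Set.Ico 0 (0 + 1/4) = Set.Ico 0 (1/4) := by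
    ext t
    simp only [Set.mem_inter_iff, Set.mem_Iic, Set.mem_Ico]
    grind
  rw [densityMeasure_bumpDensity h0 h1, bumpMeasure, Measure.add_apply, Measure.smul_apply,
    Measure.smul_apply, Measure.restrict_apply measurableSet_Iic,
    Measure.restrict_apply measurableSet_Iic, Iic_quarter_inter_Icc, hJ,
    Real.volume_Icc, Real.volume_Ico,
    smul_eq_mul, smul_eq_mul, ← ENNReal.ofReal_mul h0, ← ENNReal.ofReal_mul (by linarith),
    ← ENNReal.ofReal_add (by linarith) (by linarith), ENNReal.toReal_ofReal (by linarith)]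
  ring

lemma densityMeasure_bumpDensity_quarter_Iic {ε : ℝ} (h0 : 0 ≤ ε) (h1 : ε ≤ 1) :
    (densityMeasure (bumpDensity ε (1/4)) (Set.Iic (1/4))).toReal = ε / 4 := by
  have hJ : Set.Iic (1/4 : ℝ) ∩ Set.Ico (1/4) (1/4 + 1/4) = {1/4} := by
    ext t
    simp only [Set.mem_inter_iff, Set.mem_Iic, Set.mem_Ico, Set.mem_singleton_iff]
    grind
  rw [densityMeasure_bumpDensity h0 h1, bumpMeasure, Measure.add_apply, Measure.smul_apply,
    Measure.smul_apply, Measure.restrict_apply measurableSet_Iic,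
    Measure.restrict_apply measurableSet_Iic, Iic_quarter_inter_Icc, hJ,
    Real.volume_Icc, Real.volume_singleton,
    smul_eq_mul, smul_eq_mul, mul_zero, add_zero, ← ENNReal.ofReal_mul h0,
    ENNReal.toReal_ofReal (by linarith)]
  ring

/-- The part of the observation law on which bidder `z`, bidding in `[1/2, 3/4)`, beats `k - 1`
bidders who all bid below `1/2`. -/
noncomputable def dominatedObsMeasure {k : ℕ} (ε : ℝ) (z : Fin k) : Measure (ℝ × Fin k) :=
  (ENNReal.ofReal (1 - ε) ^ (k - 1) • bumpMeasure ε (1/2)).map fun t => (t, z)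

instance {k : ℕ} (ε : ℝ) (z : Fin k) : IsFiniteMeasure (dominatedObsMeasure ε z) := by
  have : IsFiniteMeasure (ENNReal.ofReal (1 - ε) ^ (k - 1) • bumpMeasure ε (1/2)) :=
    Measure.smul_finite _ (ENNReal.pow_ne_top ENNReal.ofReal_ne_top)
  unfold dominatedObsMeasure
  infer_instance

lemma dominatedObsMeasure_univ {k : ℕ} [NeZero k] {ε : ℝ} (hε : ε ≤ 1) (z : Fin k) :
    dominatedObsMeasure ε z Set.univ = ENNReal.ofReal (1 - ε) ^ k := by
  rw [dominatedObsMeasure, Measure.map_apply (by fun_prop) MeasurableSet.univ,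
    Set.preimage_univ, Measure.smul_apply, bumpMeasure_univ hε, smul_eq_mul, ← pow_succ,
    Nat.sub_add_cancel (NeZero.one_le)]

lemma dominatedObsMeasure_le {k : ℕ} [NeZero k] {ε : ℝ} (h0 : 0 ≤ ε) (h1 : ε ≤ 1)
    {z : Fin k} {a : Fin k → ℝ} (hz : a z = 1/2) (ha : ∀ j, j ≠ z → a j ≤ 1/4) :
    dominatedObsMeasure ε z ≤ firstPriceObsLaw fun i => bumpDensity ε (a i) := by
  have hae : (fun x : Fin k → ℝ => (⨆ i, x i, argmaxIdx x)) =ᵐ[Measure.pi fun i =>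
      bumpMeasure ε (a i)] fun x => (x z, z) := by
    have hmem : ∀ᵐ x ∂Measure.pi fun i => bumpMeasure ε (a i),
        ∀ i, x i ∈ Set.Ico (a i) (a i + 1/4) :=
      ae_all_iff.2 fun i => Measure.tendsto_eval_ae_ae.eventually (ae_bumpMeasure_mem ε (a i))
    filter_upwards [hmem] with x hx
    exact firstPriceObs_eq fun j hj => by linarith [(hx j).2, (hx z).1, ha j hj]
  calc dominatedObsMeasure ε z
      = ((Measure.pi fun i => bumpMeasure ε (a i)).map (Function.eval z)).map
          fun t => (t, z) := by
        rw [Measure.pi_map_eval, dominatedObsMeasure, hz]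
        simp only [bumpMeasure_univ h1, Finset.prod_const, Finset.card_erase_of_mem
          (Finset.mem_univ z), Finset.card_univ, Fintype.card_fin]
    _ = (Measure.pi fun i => bumpMeasure ε (a i)).map fun x => (⨆ i, x i, argmaxIdx x) := by
        rw [Measure.map_congr hae]
        exact Measure.map_map (by fun_prop) (measurable_pi_apply z)
    _ ≤ _ := by
        refine Measure.map_mono (measurePi_mono fun i => ?_) measurable_firstPriceObs
        rw [densityMeasure_bumpDensity h0 h1]
        exact Measure.le_add_left le_rfl

/-- A contamination level small enough that `m` repetitions still leave mass `1 - 2 * δ`. -/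
lemma exists_contamination (m : ℕ) {δ : ℝ} (hδ : 0 < δ) :
    ∃ ε ∈ Set.Ioo (0:ℝ) (1/2), 1 - 2 * δ ≤ (1 - ε) ^ m := by
  have hm : (0:ℝ) < m + 1 := by positivity
  refine ⟨min (1/4) (2 * δ / (m + 1)), ⟨by positivity,
    (min_le_left _ _).trans_lt (by norm_num)⟩, ?_⟩
  set ε := min (1/4 : ℝ) (2 * δ / (m + 1))
  have hε4 : ε ≤ 1/4 := min_le_left _ _
  have hε0 : 0 < ε := by positivity
  have hεm : ε * (m + 1) ≤ 2 * δ := (le_div_iff₀ hm).1 (min_le_right _ _)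
  have hb := one_add_mul_le_pow (a := -ε) (by linarith) m
  rw [← sub_eq_add_neg] at hb
  linarith

/-- For every `k ≥ 2`, sample size `n`, measurable estimator `μ̂` mapping `n`
observations to `k` probability measures on `[0,1]`, and `δ > 0`, there is a `k`-tuple of
densities on `[0,1]` whose CDFs are `λ`-anti-Lipschitz for some `λ ∈ (0,1/2)`, such that the
probability, over `n` i.i.d. samples from the corresponding first-price observation model, that
`μ̂` estimates every bid distribution within `1/4` in Kolmogorov distance is at most `1/2 + δ`. -/
theorem first_price_kolmogorov_lower_bound
    (k : ℕ) (hk : 2 ≤ k) (n : ℕ)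
    (μhat : (Fin n → ℝ × Fin k) → Fin k → Measure ℝ)
    (hμhat_meas : Measurable μhat)
    (hμhat_prob : ∀ w j, IsProbabilityMeasure (μhat w j))
    (hμhat_supp : ∀ w j, μhat w j (Set.Icc (0:ℝ) 1)ᶜ = 0)
    (δ : ℝ) (hδ : 0 < δ) :
    haveI : NeZero k := ⟨by omega⟩
    ∃ (f : Fin k → ℝ → ℝ) (lam : ℝ), lam ∈ Set.Ioo (0:ℝ) (1/2) ∧
      (∀ i, IsDensityOn01 (f i)) ∧
      (∀ i, ∀ x ∈ Set.Icc (0:ℝ) 1, ∀ y ∈ Set.Icc (0:ℝ) 1,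
        lam * |x - y| ≤ |cdfOf (f i) x - cdfOf (f i) y|) ∧
      firstPriceSamplesLaw n f
          {w | ∀ j, kolmogorovDist (μhat w j) (densityMeasure (f j)) ≤ 1/4}
        ≤ ENNReal.ofReal (1/2 + δ) := by
  have : NeZero k := ⟨by omega⟩
  obtain ⟨ε, ⟨h0, hhalf⟩, hpow⟩ := exists_contamination (k * n) hδ
  have h1 : ε ≤ 1 := by linarith
  set z : Fin k := ⟨0, by omega⟩ with hz
  set o : Fin k := ⟨1, by omega⟩ with ho
  have hoz : o ≠ z := by simp [hz, ho]
  let a : ℝ → Fin k → ℝ := fun b i => if i = z then 1/2 else b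
  let f : ℝ → Fin k → ℝ → ℝ := fun b i => bumpDensity ε (a b i)
  have haz : ∀ b, a b z = 1/2 := fun b => if_pos rfl
  have ha : ∀ b j, j ≠ z → a b j = b := fun b j hj => if_neg hj
  have hdens : ∀ b ∈ Set.Icc (0:ℝ) (1/4), ∀ i, IsDensityOn01 (f b i) := by
    intro b hb i
    rcases eq_or_ne i z with rfl | hi
    · exact isDensityOn01_bumpDensity h0.le h1 (by rw [haz]; norm_num) (by rw [haz]; norm_num)
    · exact isDensityOn01_bumpDensity h0.le h1 (by rw [ha b i hi]; exact hb.1)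
        (by rw [ha b i hi]; linarith [hb.2])
  by_contra! hcon
  let A : ℝ → Set (Fin n → ℝ × Fin k) := fun b =>
    {w | |(μhat w o (Set.Iic (1/4))).toReal -
      (densityMeasure (f b o) (Set.Iic (1/4))).toReal| ≤ 1/4}
  have hA : ∀ b, MeasurableSet (A b) := fun b => by
    have hcdf : Measurable fun w => (μhat w o (Set.Iic (1/4))).toReal :=
      ((Measure.measurable_coe measurableSet_Iic).comp
        ((measurable_pi_apply o).comp hμhat_meas)).ennreal_toReal
    exact measurableSet_le (hcdf.sub_const _).abs measurable_const
  have hlarge : ∀ b ∈ Set.Icc (0:ℝ) (1/4),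
      ENNReal.ofReal (1/2 + δ) < firstPriceSamplesLaw n (f b) (A b) := by
    intro b hb
    refine (hcon (f b) ε ⟨h0, hhalf⟩ (hdens b hb) fun i x hx y hy =>
      mul_abs_sub_le_cdfOf_bumpDensity h1 _ hx hy).trans_le (measure_mono fun w hw => ?_)
    have := hμhat_prob w o
    have := isProbabilityMeasure_densityMeasure (hdens b hb o)
    exact (abs_sub_le_kolmogorovDist _ _ _).trans (hw o)
  have hmem0 : (0:ℝ) ∈ Set.Icc (0:ℝ) (1/4) := by norm_num
  have hmem1 : (1/4:ℝ) ∈ Set.Icc (0:ℝ) (1/4) := by norm_num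
  have hdisj : Disjoint (A 0) (A (1/4)) := by
    refine Set.disjoint_left.2 fun w hw hw' => ?_
    simp only [A, f, Set.mem_ofPred_eq, ha _ o hoz, densityMeasure_bumpDensity_zero_Iic h0.le h1,
      densityMeasure_bumpDensity_quarter_Iic h0.le h1, abs_le] at hw hw'
    linarith [hw.1, hw'.2]
  have hprob : ∀ b ∈ Set.Icc (0:ℝ) (1/4),
      IsProbabilityMeasure (firstPriceSamplesLaw n (f b)) := fun b hb => by
    have := isProbabilityMeasure_firstPriceObsLaw (hdens b hb)
    unfold firstPriceSamplesLaw
    infer_instance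
  have hdom : ∀ b ∈ Set.Icc (0:ℝ) (1/4),
      (Measure.pi fun _ : Fin n => dominatedObsMeasure ε z) ≤ firstPriceSamplesLaw n (f b) :=
    fun b hb => measurePi_mono fun _ =>
      dominatedObsMeasure_le h0.le h1 (haz b) fun j hj => (ha b j hj).trans_le hb.2
  have := hprob 0 hmem0
  have := hprob (1/4) hmem1
  have htwo := measure_add_measure_add_le_two (hdom 0 hmem0) (hdom (1/4) hmem1)
    (hA 0) (hA (1/4)) hdisj
  have hmass : ENNReal.ofReal (1 - 2 * δ) ≤
      (Measure.pi fun _ : Fin n => dominatedObsMeasure ε z) Set.univ := by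
    rw [Measure.pi_univ]
    simp only [dominatedObsMeasure_univ h1, Finset.prod_const, Finset.card_univ,
      Fintype.card_fin]
    rw [← pow_mul, ← ENNReal.ofReal_pow (by linarith)]
    exact ENNReal.ofReal_le_ofReal hpow
  have hsum : (2 : ℝ≥0∞) ≤ ENNReal.ofReal (1/2 + δ) + ENNReal.ofReal (1/2 + δ) +
      ENNReal.ofReal (1 - 2 * δ) := by
    rw [← ENNReal.ofReal_add (by linarith) (by linarith)]
    refine le_trans ?_ ENNReal.ofReal_add_le
    rw [← ENNReal.ofReal_ofNat 2]
    exact ENNReal.ofReal_le_ofReal (by linarith)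
  refine (hsum.trans_lt ?_).not_ge htwo
  exact ENNReal.add_lt_add_of_lt_of_le ENNReal.ofReal_ne_top
    (ENNReal.add_lt_add (hlarge 0 hmem0) (hlarge (1/4) hmem1)) hmass
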